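/- arXiv:0903.4134 — 3 statements merged into one kernel-verified Lean document; each statement's English description precedes it below -/
import Mathlib

section
/- Let u, w : ℝ × ℝ → ℝ be smooth and spatially periodic, and suppose μ(w)(t) − w_xx(t,x) = u(t,x) for all (t,x) (i.e. w = Λ_μ⁻² u). Then u satisfies the μDP equation μ(u_t)(t) − u_txx + 3μ(u)(t) u_x − 3u_x u_xx − u u_xxx = 0 at every point of ℝ × ℝ if and only if u satisfies the nonlocal equation u_t(t,x) + u(t,x) u_x(t,x) + 3 μ(u)(t) w_x(t,x) = 0 at every point of ℝ × ℝ. -/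
open intervalIntegral

/-- Partial derivative in the second (spatial) variable. -/
noncomputable def pdx (u : ℝ × ℝ → ℝ) : ℝ × ℝ → ℝ := fun p => deriv (fun y => u (p.1, y)) p.2

/-- Partial derivative in the first (time) variable. -/
noncomputable def pdt (u : ℝ × ℝ → ℝ) : ℝ × ℝ → ℝ := fun p => deriv (fun s => u (s, p.2)) p.1

/-- The spatial mean `μ(u)(t) = ∫₀¹ u(t,x) dx`. -/
noncomputable def muMean (u : ℝ × ℝ → ℝ) (t : ℝ) : ℝ := ∫ x in (0:ℝ)..1, u (t, x)

lemma hasDerivAt_pdx {v : ℝ × ℝ → ℝ} (hv : ContDiff ℝ (⊤ : ℕ∞) v) (t x : ℝ) :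
    HasDerivAt (fun y => v (t, y)) (pdx v (t, x)) x := by
  have hd : Differentiable ℝ v := hv.differentiable (by simp)
  have : DifferentiableAt ℝ (fun y => v (t, y)) x := by fun_prop
  exact this.hasDerivAt

lemma pdx_eq_fderiv {v : ℝ × ℝ → ℝ} (hv : ContDiff ℝ (⊤ : ℕ∞) v) :
    pdx v = fun p => fderiv ℝ v p (0, 1) := by
  funext p
  have hd : DifferentiableAt ℝ v p := hv.differentiable (by simp) p
  exact (hd.hasFDerivAt.comp_hasDerivAt (f := fun y => (p.1, y)) p.2
    ((hasDerivAt_const p.2 p.1).prodMk (hasDerivAt_id p.2))).deriv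

lemma pdt_eq_fderiv {v : ℝ × ℝ → ℝ} (hv : ContDiff ℝ (⊤ : ℕ∞) v) :
    pdt v = fun p => fderiv ℝ v p (1, 0) := by
  funext p
  have hd : DifferentiableAt ℝ v p := hv.differentiable (by simp) p
  exact (hd.hasFDerivAt.comp_hasDerivAt (f := fun s => (s, p.2)) p.1
    ((hasDerivAt_id p.1).prodMk (hasDerivAt_const p.1 p.2))).deriv

lemma contDiff_pdx {v : ℝ × ℝ → ℝ} (hv : ContDiff ℝ (⊤ : ℕ∞) v) :
    ContDiff ℝ (⊤ : ℕ∞) (pdx v) := by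
  rw [pdx_eq_fderiv hv]
  exact (hv.fderiv_right (m := (⊤ : ℕ∞)) (by simp)).clm_apply contDiff_const

lemma contDiff_pdt {v : ℝ × ℝ → ℝ} (hv : ContDiff ℝ (⊤ : ℕ∞) v) :
    ContDiff ℝ (⊤ : ℕ∞) (pdt v) := by
  rw [pdt_eq_fderiv hv]
  exact (hv.fderiv_right (m := (⊤ : ℕ∞)) (by simp)).clm_apply contDiff_const

lemma pdx_periodic {v : ℝ × ℝ → ℝ} (hper : ∀ t x, v (t, x + 1) = v (t, x)) (t x : ℝ) :
    pdx v (t, x + 1) = pdx v (t, x) := by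
  simp only [pdx]
  rw [← deriv_comp_add_const]
  simp only [hper]

lemma pdt_periodic {v : ℝ × ℝ → ℝ} (hper : ∀ t x, v (t, x + 1) = v (t, x)) (t x : ℝ) :
    pdt v (t, x + 1) = pdt v (t, x) := by
  simp only [pdt, hper]

lemma muMean_pdx_eq_zero {v : ℝ × ℝ → ℝ} (hv : ContDiff ℝ (⊤ : ℕ∞) v)
    (hper : ∀ t x, v (t, x + 1) = v (t, x)) (t : ℝ) : muMean (pdx v) t = 0 := by
  have hc : Continuous (pdx v) := (contDiff_pdx hv).continuous
  have hc' : Continuous fun x => pdx v (t, x) := by fun_prop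
  rw [muMean, integral_eq_sub_of_hasDerivAt (fun x _ => hasDerivAt_pdx hv t x)
    (hc'.intervalIntegrable 0 1)]
  have := hper t 0
  rw [zero_add] at this
  rw [this, sub_self]

lemma pdx_add {f g : ℝ × ℝ → ℝ} (hf : ContDiff ℝ (⊤ : ℕ∞) f) (hg : ContDiff ℝ (⊤ : ℕ∞) g) :
    pdx (f + g) = pdx f + pdx g := by
  funext p
  exact ((hasDerivAt_pdx hf p.1 p.2).add (hasDerivAt_pdx hg p.1 p.2)).deriv

lemma pdx_mul {f g : ℝ × ℝ → ℝ} (hf : ContDiff ℝ (⊤ : ℕ∞) f) (hg : ContDiff ℝ (⊤ : ℕ∞) g) :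
    pdx (f * g) = pdx f * g + f * pdx g := by
  funext p
  exact ((hasDerivAt_pdx hf p.1 p.2).mul (hasDerivAt_pdx hg p.1 p.2)).deriv

lemma pdx_smul {f : ℝ × ℝ → ℝ} (hf : ContDiff ℝ (⊤ : ℕ∞) f) (c : ℝ) :
    pdx (c • f) = c • pdx f := by
  funext p
  exact ((hasDerivAt_pdx hf p.1 p.2).const_smul c).deriv

lemma muMean_add {f g : ℝ × ℝ → ℝ} (hf : Continuous f) (hg : Continuous g) (t : ℝ) :
    muMean (f + g) t = muMean f t + muMean g t := by
  have hf' : Continuous fun x => f (t, x) := by fun_prop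
  have hg' : Continuous fun x => g (t, x) := by fun_prop
  exact integral_add (hf'.intervalIntegrable 0 1) (hg'.intervalIntegrable 0 1)

lemma muMean_eq_of_const {f : ℝ × ℝ → ℝ} {t c : ℝ} (h : ∀ x, f (t, x) = c) :
    muMean f t = c := by
  simp [muMean, h]

/-- A periodic function with constant spatial derivative on a time slice is constant there. -/
lemma const_of_pdx_const {v : ℝ × ℝ → ℝ} (hv : ContDiff ℝ (⊤ : ℕ∞) v)
    (hper : ∀ t x, v (t, x + 1) = v (t, x)) {t k : ℝ} (hk : ∀ x, pdx v (t, x) = k) :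
    k = 0 ∧ ∀ x, v (t, x) = v (t, 0) := by
  have h0 : k = 0 := (muMean_eq_of_const hk).symm.trans (muMean_pdx_eq_zero hv hper t)
  refine ⟨h0, fun x => is_const_of_deriv_eq_zero (f := fun y => v (t, y))
    (fun y => (hasDerivAt_pdx hv t y).differentiableAt) (fun y => ?_) x 0⟩
  rw [(hasDerivAt_pdx hv t y).deriv, hk, h0]

/-- The operator `Λ_μ²` is injective on each time slice. -/
lemma muMean_sub_pdx_pdx_eq_zero_iff {v : ℝ × ℝ → ℝ} (hv : ContDiff ℝ (⊤ : ℕ∞) v)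
    (hper : ∀ t x, v (t, x + 1) = v (t, x)) (t : ℝ) :
    (∀ x, muMean v t - pdx (pdx v) (t, x) = 0) ↔ ∀ x, v (t, x) = 0 := by
  constructor
  · intro h
    obtain ⟨hμ, h1⟩ := const_of_pdx_const (contDiff_pdx hv) (pdx_periodic hper)
      (fun x => (sub_eq_zero.mp (h x)).symm)
    obtain ⟨-, h2⟩ := const_of_pdx_const hv hper h1
    intro x
    rw [h2 x, ← muMean_eq_of_const h2, hμ]
  · intro h x
    have h1 : ∀ y, pdx v (t, y) = 0 := fun y => by simp [pdx, h]
    have h2 : pdx (pdx v) (t, x) = 0 := by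
      change deriv (fun y => pdx v (t, y)) x = 0
      simp [h1]
    rw [muMean_eq_of_const h, h2, sub_zero]

/-- with `w = Λ_μ⁻² u`, the μDP equation is equivalent to its nonlocal
form `u_t + u u_x + 3 μ(u) w_x = 0`. -/
theorem muDP_nonlocal_form
    (u w : ℝ × ℝ → ℝ) (hu : ContDiff ℝ (⊤ : ℕ∞) u) (hw : ContDiff ℝ (⊤ : ℕ∞) w)
    (huper : ∀ t x, u (t, x + 1) = u (t, x)) (hwper : ∀ t x, w (t, x + 1) = w (t, x))
    (hinv : ∀ t x : ℝ, muMean w t - pdx (pdx w) (t, x) = u (t, x)) :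
    (∀ t x : ℝ,
        muMean (pdt u) t - pdx (pdx (pdt u)) (t, x) + 3 * muMean u t * pdx u (t, x)
          - 3 * pdx u (t, x) * pdx (pdx u) (t, x) - u (t, x) * pdx (pdx (pdx u)) (t, x) = 0)
      ↔ (∀ t x : ℝ,
          pdt u (t, x) + u (t, x) * pdx u (t, x) + 3 * muMean u t * pdx w (t, x) = 0) := by
  have hux := contDiff_pdx hu
  have huxx := contDiff_pdx hux
  have hwx := contDiff_pdx hw
  have hut := contDiff_pdt hu
  have hwxxx : ∀ t x, pdx (pdx (pdx w)) (t, x) = -pdx u (t, x) := by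
    intro t x
    have hw2 : (fun y => pdx (pdx w) (t, y)) = fun y => muMean w t - u (t, y) := by
      funext y
      linarith [hinv t y]
    change deriv (fun y => pdx (pdx w) (t, y)) x = _
    rw [hw2]
    exact ((hasDerivAt_pdx hu t x).const_sub _).deriv
  refine forall_congr' fun t => ?_
  set c := muMean u t
  -- The nonlocal expression on the slice `t` is `u_t + g_x`.
  let g : ℝ × ℝ → ℝ := (1 / 2 : ℝ) • (u * u) + (3 * c) • w
  have huu : ContDiff ℝ (⊤ : ℕ∞) (u * u) := hu.mul hu
  have hhuu : ContDiff ℝ (⊤ : ℕ∞) ((1 / 2 : ℝ) • (u * u)) := huu.const_smul (1 / 2 : ℝ)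
  have hcw : ContDiff ℝ (⊤ : ℕ∞) ((3 * c) • w) := hw.const_smul (3 * c)
  have hg : ContDiff ℝ (⊤ : ℕ∞) g := hhuu.add hcw
  have hgper : ∀ t x, g (t, x + 1) = g (t, x) := fun t x => by simp [g, huper, hwper]
  have hgx : pdx g = u * pdx u + (3 * c) • pdx w := by
    rw [pdx_add hhuu hcw, pdx_smul huu, pdx_smul hw, pdx_mul hu hu]
    funext p
    simp only [Pi.add_apply, Pi.smul_apply, Pi.mul_apply, smul_eq_mul]
    ring
  have hgxxx : pdx (pdx (pdx g)) =
      pdx (pdx u) * pdx u + pdx u * pdx (pdx u) + (pdx u * pdx (pdx u) + u * pdx (pdx (pdx u)))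
        + (3 * c) • pdx (pdx (pdx w)) := by
    have huux : ContDiff ℝ (⊤ : ℕ∞) (u * pdx u) := hu.mul hux
    have hcwx : ContDiff ℝ (⊤ : ℕ∞) ((3 * c) • pdx w) := hwx.const_smul (3 * c)
    have hcwxx : ContDiff ℝ (⊤ : ℕ∞) ((3 * c) • pdx (pdx w)) :=
      (contDiff_pdx hwx).const_smul (3 * c)
    have huxux : ContDiff ℝ (⊤ : ℕ∞) (pdx u * pdx u) := hux.mul hux
    have huuxx : ContDiff ℝ (⊤ : ℕ∞) (u * pdx (pdx u)) := hu.mul huxx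
    have hsum : ContDiff ℝ (⊤ : ℕ∞) (pdx u * pdx u + u * pdx (pdx u)) := huxux.add huuxx
    rw [hgx, pdx_add huux hcwx, pdx_smul hwx, pdx_mul hu hux, pdx_add hsum hcwxx,
      pdx_smul (contDiff_pdx hwx), pdx_add huxux huuxx, pdx_mul hux hux, pdx_mul hu huxx]
  have hgx' := contDiff_pdx hg
  have hF := muMean_sub_pdx_pdx_eq_zero_iff (hut.add hgx')
    (fun t x => congrArg₂ (· + ·) (pdt_periodic huper t x) (pdx_periodic hgper t x)) t
  refine Iff.trans (forall_congr' fun x => ?_) (hF.trans (forall_congr' fun x => ?_))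
  · change _ ↔ muMean (pdt u + pdx g) t - pdx (pdx (pdt u + pdx g)) (t, x) = 0
    rw [muMean_add hut.continuous hgx'.continuous, muMean_pdx_eq_zero hg hgper,
      pdx_add hut hgx', pdx_add (contDiff_pdx hut) (contDiff_pdx hgx'), hgxxx]
    simp only [Pi.add_apply, Pi.smul_apply, Pi.mul_apply, smul_eq_mul, hwxxx]
    refine Eq.congr ?_ rfl
    ring
  · rw [hgx]
    simp only [Pi.add_apply, Pi.smul_apply, Pi.mul_apply, smul_eq_mul, add_assoc]
end

section
/- Let λ ∈ ℝ, let I ⊆ ℝ be an open interval containing 0, and let u : ℝ × ℝ → ℝ be smooth, spatially periodic, and satisfy the μ-equation μ(u_t)(t) − u_txx + λ μ(u)(t) u_x − λ u_x u_xx − u u_xxx = 0 for all t ∈ I and x ∈ ℝ. Let ξ : I × ℝ → ℝ be smooth with ∂_t ξ(t,x) = u(t, ξ(t,x)) and ξ(0,x) = x (the flow of u). Then for all t ∈ I and x ∈ ℝ one has ∂_x ξ(t,x) > 0 and the pointwise conservation law ( μ(u)(t) − u_xx(t, ξ(t,x)) ) · (∂_x ξ(t,x))^λ = μ(u)(0)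 − u_xx(0, x), where the power is the real power of the positive number ∂_x ξ(t,x). -/
open intervalIntegral

section

open Set Filter Topology MeasureTheory

lemma hasDerivAt_pdx_s8 {f : ℝ × ℝ → ℝ} {p : ℝ × ℝ} (hf : DifferentiableAt ℝ f p) :
    HasDerivAt (fun y => f (p.1, y)) (fderiv ℝ f p (0, 1)) p.2 :=
  hf.hasFDerivAt.comp_hasDerivAt p.2 ((hasDerivAt_const p.2 p.1).prodMk (hasDerivAt_id p.2))

lemma hasDerivAt_pdt {f : ℝ × ℝ → ℝ} {p : ℝ × ℝ} (hf : DifferentiableAt ℝ f p) :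
    HasDerivAt (fun s => f (s, p.2)) (fderiv ℝ f p (1, 0)) p.1 :=
  hf.hasFDerivAt.comp_hasDerivAt p.1 ((hasDerivAt_id p.1).prodMk (hasDerivAt_const p.1 p.2))

lemma pdx_eq_fderiv_s8 {f : ℝ × ℝ → ℝ} {p : ℝ × ℝ} (hf : DifferentiableAt ℝ f p) :
    pdx f p = fderiv ℝ f p (0, 1) :=
  (hasDerivAt_pdx_s8 hf).deriv

lemma pdt_eq_fderiv_s8 {f : ℝ × ℝ → ℝ} {p : ℝ × ℝ} (hf : DifferentiableAt ℝ f p) :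
    pdt f p = fderiv ℝ f p (1, 0) :=
  (hasDerivAt_pdt hf).deriv

lemma eventually_differentiableAt {f : ℝ × ℝ → ℝ} {p : ℝ × ℝ}
    (hf : ContDiffAt ℝ (⊤ : ℕ∞) f p) : ∀ᶠ q in 𝓝 p, DifferentiableAt ℝ f q := by
  have h : ContDiffAt ℝ 1 f p := hf.of_le (by exact_mod_cast le_top)
  filter_upwards [h.eventually (by simp)] with q hq
  exact hq.differentiableAt one_ne_zero

lemma contDiffAt_fderiv_apply {f : ℝ × ℝ → ℝ} {p : ℝ × ℝ}
    (hf : ContDiffAt ℝ (⊤ : ℕ∞) f p) (v : ℝ × ℝ) :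
    ContDiffAt ℝ (⊤ : ℕ∞) (fun q => fderiv ℝ f q v) p :=
  (hf.fderiv_right (m := (⊤ : ℕ∞)) (by simp)).clm_apply contDiffAt_const

lemma pdx_eventuallyEq {f : ℝ × ℝ → ℝ} {p : ℝ × ℝ} (hf : ContDiffAt ℝ (⊤ : ℕ∞) f p) :
    pdx f =ᶠ[𝓝 p] fun q => fderiv ℝ f q (0, 1) :=
  (eventually_differentiableAt hf).mono fun _ hq => pdx_eq_fderiv_s8 hq

lemma pdt_eventuallyEq {f : ℝ × ℝ → ℝ} {p : ℝ × ℝ} (hf : ContDiffAt ℝ (⊤ : ℕ∞) f p) :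
    pdt f =ᶠ[𝓝 p] fun q => fderiv ℝ f q (1, 0) :=
  (eventually_differentiableAt hf).mono fun _ hq => pdt_eq_fderiv_s8 hq

lemma ContDiffAt.partial_x {f : ℝ × ℝ → ℝ} {p : ℝ × ℝ} (hf : ContDiffAt ℝ (⊤ : ℕ∞) f p) :
    ContDiffAt ℝ (⊤ : ℕ∞) (pdx f) p :=
  (contDiffAt_fderiv_apply hf _).congr_of_eventuallyEq (pdx_eventuallyEq hf)

lemma ContDiffAt.partial_t {f : ℝ × ℝ → ℝ} {p : ℝ × ℝ} (hf : ContDiffAt ℝ (⊤ : ℕ∞) f p) :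
    ContDiffAt ℝ (⊤ : ℕ∞) (pdt f) p :=
  (contDiffAt_fderiv_apply hf _).congr_of_eventuallyEq (pdt_eventuallyEq hf)

lemma ContDiff.partial_x {f : ℝ × ℝ → ℝ} (hf : ContDiff ℝ (⊤ : ℕ∞) f) :
    ContDiff ℝ (⊤ : ℕ∞) (pdx f) :=
  contDiff_iff_contDiffAt.2 fun _ => hf.contDiffAt.partial_x

lemma ContDiff.partial_t {f : ℝ × ℝ → ℝ} (hf : ContDiff ℝ (⊤ : ℕ∞) f) :
    ContDiff ℝ (⊤ : ℕ∞) (pdt f) :=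
  contDiff_iff_contDiffAt.2 fun _ => hf.contDiffAt.partial_t

lemma pdt_pdx_comm {f : ℝ × ℝ → ℝ} {p : ℝ × ℝ} (hf : ContDiffAt ℝ (⊤ : ℕ∞) f p) :
    pdt (pdx f) p = pdx (pdt f) p := by
  have hd : DifferentiableAt ℝ (fderiv ℝ f) p :=
    (hf.fderiv_right (m := (⊤ : ℕ∞)) (by simp)).differentiableAt (by simp)
  have happ (v w : ℝ × ℝ) :
      fderiv ℝ (fun q => fderiv ℝ f q v) p w = fderiv ℝ (fderiv ℝ f) p w v := by
    rw [fderiv_clm_apply hd (differentiableAt_const v)]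
    simp
  rw [pdt_eq_fderiv_s8 (hf.partial_x.differentiableAt (by simp)),
    pdx_eq_fderiv_s8 (hf.partial_t.differentiableAt (by simp)),
    (pdx_eventuallyEq hf).fderiv_eq, (pdt_eventuallyEq hf).fderiv_eq, happ, happ]
  refine hf.isSymmSndFDerivAt ?_ _ _
  rw [minSmoothness_of_isRCLikeNormedField]
  exact WithTop.coe_le_coe.2 (le_top : (2 : ℕ∞) ≤ ⊤)

lemma hasDerivAt_along_curve {f : ℝ × ℝ → ℝ} {c : ℝ → ℝ} {c' t : ℝ}
    (hf : DifferentiableAt ℝ f (t, c t)) (hc : HasDerivAt c c' t) :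
    HasDerivAt (fun s => f (s, c s)) (pdt f (t, c t) + c' * pdx f (t, c t)) t := by
  have h := hf.hasFDerivAt.comp_hasDerivAt t ((hasDerivAt_id t).prodMk hc)
  have hv : ((1 : ℝ), c') = (1, 0) + c' • ((0 : ℝ), (1 : ℝ)) := by simp
  rw [hv, map_add, map_smul, smul_eq_mul, ← pdt_eq_fderiv_s8 hf, ← pdx_eq_fderiv_s8 hf] at h
  exact h

lemma hasDerivAt_muMean {u : ℝ × ℝ → ℝ} (hu : ContDiff ℝ (⊤ : ℕ∞) u) (t : ℝ) :
    HasDerivAt (muMean u) (muMean (pdt u) t) t := by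
  have hcont := hu.partial_t.continuous
  obtain ⟨C, hC⟩ := ((isCompact_closedBall t 1).prod
    (isCompact_Icc (a := (0 : ℝ)) (b := 1))).exists_bound_of_continuousOn hcont.continuousOn
  refine (intervalIntegral.hasDerivAt_integral_of_dominated_loc_of_deriv_le
    (F := fun s x => u (s, x)) (F' := fun s x => pdt u (s, x)) (bound := fun _ => C)
    (Metric.closedBall_mem_nhds t one_pos) ?_ ?_ ?_ ?_ ?_ ?_).2
  · refine Eventually.of_forall fun s => Continuous.aestronglyMeasurable ?_
    exact hu.continuous.comp (by fun_prop)
  · exact (hu.continuous.comp (by fun_prop : Continuous fun x : ℝ => (t, x))).intervalIntegrable _ _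
  · exact (hcont.comp (by fun_prop : Continuous fun x : ℝ => (t, x))).aestronglyMeasurable
  · refine Eventually.of_forall fun x hx s hs => hC (s, x) ⟨hs, ?_⟩
    rw [uIoc_of_le zero_le_one] at hx
    exact Ioc_subset_Icc_self hx
  · exact intervalIntegrable_const
  · refine Eventually.of_forall fun x _ s _ => ?_
    have hd : DifferentiableAt ℝ u (s, x) := hu.contDiffAt.differentiableAt (by simp)
    rw [pdt_eq_fderiv_s8 hd]
    exact hasDerivAt_pdt hd

lemma hasDerivAt_primitive_of_continuousOn {I : Set ℝ} (hI : IsOpen I) (hconv : Convex ℝ I)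
    {a t : ℝ} (ha : a ∈ I) (ht : t ∈ I) {b : ℝ → ℝ} (hb : ContinuousOn b I) :
    HasDerivAt (fun s => ∫ r in a..s, b r) (b t) t :=
  intervalIntegral.integral_hasDerivAt_right
    (hb.mono (hconv.ordConnected.uIcc_subset ha ht)).intervalIntegrable
    (hb.stronglyMeasurableAtFilter hI t ht) (hb.continuousAt (hI.mem_nhds ht))

lemma eq_mul_exp_of_hasDerivAt {I : Set ℝ} (hI : IsOpen I) (hconv : Convex ℝ I) {y b B : ℝ → ℝ}
    (hy : ∀ t ∈ I, HasDerivAt y (b t * y t) t) (hB : ∀ t ∈ I, HasDerivAt B (b t) t)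
    {a t : ℝ} (ha : a ∈ I) (ht : t ∈ I) : y t = y a * Real.exp (B t - B a) := by
  have hd : ∀ s ∈ I, HasDerivAt (fun r => y r * Real.exp (-B r)) 0 s := fun s hs => by
    refine ((hy s hs).mul (hB s hs).neg.exp).congr_deriv ?_
    ring
  have h := hI.is_const_of_deriv_eq_zero hconv.isPreconnected
    (fun s hs => (hd s hs).differentiableAt.differentiableWithinAt)
    (fun s hs => (hd s hs).deriv) ha ht
  have h1 : Real.exp (-B t) * Real.exp (B t) = 1 := by rw [← Real.exp_add]; simp
  rw [sub_eq_add_neg, add_comm, Real.exp_add, ← mul_assoc, h, mul_assoc, h1, mul_one]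

end

/-- the momentum density `m = μ(u) − u_xx` of a solution of the μ-equation
transforms as a tensor density of weight λ along the flow ξ of u:
`m(t, ξ(t,x)) (∂_x ξ(t,x))^λ = m(0,x)`, with `∂_x ξ > 0`. -/
theorem mu_equation_pointwise_conservation
    (lam : ℝ) (I : Set ℝ) (hIopen : IsOpen I) (hIconv : Convex ℝ I) (h0I : (0:ℝ) ∈ I)
    (u : ℝ × ℝ → ℝ) (hu : ContDiff ℝ (⊤ : ℕ∞) u)
    (hper : ∀ t x, u (t, x + 1) = u (t, x))
    (heq : ∀ t ∈ I, ∀ x : ℝ,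
      muMean (pdt u) t - pdx (pdx (pdt u)) (t, x) + lam * muMean u t * pdx u (t, x)
        - lam * pdx u (t, x) * pdx (pdx u) (t, x) - u (t, x) * pdx (pdx (pdx u)) (t, x) = 0)
    (ξ : ℝ × ℝ → ℝ) (hξ : ContDiffOn ℝ (⊤ : ℕ∞) ξ (I ×ˢ (Set.univ : Set ℝ)))
    (hflow : ∀ t ∈ I, ∀ x : ℝ, pdt ξ (t, x) = u (t, ξ (t, x)))
    (hinit : ∀ x : ℝ, ξ (0, x) = x) :
    ∀ t ∈ I, ∀ x : ℝ, 0 < pdx ξ (t, x) ∧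
      (muMean u t - pdx (pdx u) (t, ξ (t, x))) * (pdx ξ (t, x)) ^ lam
        = muMean u 0 - pdx (pdx u) (0, x) := by
  intro t ht x
  have hξat (s : ℝ) (hs : s ∈ I) (y : ℝ) : ContDiffAt ℝ (⊤ : ℕ∞) ξ (s, y) :=
    hξ.contDiffAt ((hIopen.prod isOpen_univ).mem_nhds ⟨hs, Set.mem_univ y⟩)
  have hud {f : ℝ × ℝ → ℝ} (hf : ContDiff ℝ (⊤ : ℕ∞) f) (p : ℝ × ℝ) : DifferentiableAt ℝ f p :=
    hf.contDiffAt.differentiableAt (by simp)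
  have hξt (s : ℝ) (hs : s ∈ I) : HasDerivAt (fun r => ξ (r, x)) (u (s, ξ (s, x))) s := by
    have hd : DifferentiableAt ℝ ξ (s, x) := (hξat s hs x).differentiableAt (by simp)
    rw [← hflow s hs x, pdt_eq_fderiv_s8 hd]
    exact hasDerivAt_pdt hd
  have hjac (s : ℝ) (hs : s ∈ I) : HasDerivAt (fun r => pdx ξ (r, x))
      (pdx u (s, ξ (s, x)) * pdx ξ (s, x)) s := by
    have hd : DifferentiableAt ℝ ξ (s, x) := (hξat s hs x).differentiableAt (by simp)
    have hd' : DifferentiableAt ℝ (pdx ξ) (s, x) := (hξat s hs x).partial_x.differentiableAt (by simp)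
    have hchain : pdx (pdt ξ) (s, x) = pdx u (s, ξ (s, x)) * pdx ξ (s, x) := by
      have hfun : (fun y => pdt ξ (s, y)) = fun y => u (s, ξ (s, y)) :=
        funext fun y => hflow s hs y
      have hout := hasDerivAt_pdx_s8 (hud hu (s, ξ (s, x)))
      rw [← pdx_eq_fderiv_s8 (hud hu _)] at hout
      have hin := hasDerivAt_pdx_s8 hd
      rw [← pdx_eq_fderiv_s8 hd] at hin
      change deriv (fun y => pdt ξ (s, y)) x = _
      rw [hfun]
      exact (HasDerivAt.comp x hout hin).deriv
    rw [← hchain, ← pdt_pdx_comm (hξat s hs x), pdt_eq_fderiv_s8 hd']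
    exact hasDerivAt_pdt hd'
  have hmom (s : ℝ) (hs : s ∈ I) :
      HasDerivAt (fun r => muMean u r - pdx (pdx u) (r, ξ (r, x)))
        (-lam * pdx u (s, ξ (s, x)) * (muMean u s - pdx (pdx u) (s, ξ (s, x)))) s := by
    have hcomm : pdt (pdx (pdx u)) (s, ξ (s, x)) = pdx (pdx (pdt u)) (s, ξ (s, x)) := by
      rw [pdt_pdx_comm hu.partial_x.contDiffAt,
        show pdt (pdx u) = pdx (pdt u) from funext fun _ => pdt_pdx_comm hu.contDiffAt]
    refine ((hasDerivAt_muMean hu s).sub (hasDerivAt_along_curve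
      (hud hu.partial_x.partial_x (s, ξ (s, x))) (hξt s hs))).congr_deriv ?_
    rw [hcomm]
    linear_combination heq s hs (ξ (s, x))
  have hcont : ContinuousOn (fun s => pdx u (s, ξ (s, x))) I := fun s hs =>
    (hasDerivAt_along_curve (hud hu.partial_x (s, ξ (s, x)))
      (hξt s hs)).continuousAt.continuousWithinAt
  have hB (s : ℝ) (hs : s ∈ I) := hasDerivAt_primitive_of_continuousOn hIopen hIconv h0I hs hcont
  have hjac0 : pdx ξ (0, x) = 1 := by
    simp [pdx, hinit]
  have hJ := eq_mul_exp_of_hasDerivAt hIopen hIconv hjac hB h0I ht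
  have hM := eq_mul_exp_of_hasDerivAt hIopen hIconv hmom
    (fun s hs => (hB s hs).const_mul (-lam)) h0I ht
  simp only [intervalIntegral.integral_same, mul_zero, sub_zero, hjac0, one_mul, hinit] at hJ hM
  rw [hJ, hM, ← Real.exp_mul, mul_assoc, ← Real.exp_add]
  refine ⟨Real.exp_pos _, ?_⟩
  rw [show ∀ z : ℝ, -lam * z + z * lam = 0 from fun z => by ring, Real.exp_zero, mul_one]
end

section
/- Let u : ℝ × ℝ → ℝ be smooth and spatially periodic, and let I ⊆ ℝ be an open interval. Then u satisfies the μBurgers equation u_txx(t,x) + 3 u_x(t,x) u_xx(t,x) + u(t,x) u_xxx(t,x) = 0 for all t ∈ I and x ∈ ℝ if and only if u satisfies u_t(t,x) + u(t,x) u_x(t,x) = μ(u_t)(t) for all t ∈ I and x ∈ ℝ, where μ(u_t)(t) = ∫₀¹ u_t(t,y) dy. In particular, for a solution of μBurgers the quantity u_t + u u_x is independent of x. -/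
open intervalIntegral

/-- A function on `ℝ` with vanishing second derivative and equal values at `0` and `1` is
constant. -/
theorem eq_apply_zero_of_hasDerivAt_hasDerivAt_zero {h h' : ℝ → ℝ}
    (hh : ∀ x, HasDerivAt h (h' x) x) (hh' : ∀ x, HasDerivAt h' 0 x) (h01 : h 1 = h 0) (x : ℝ) :
    h x = h 0 := by
  have hc : ∀ y, h' y = h' 0 := fun y =>
    is_const_of_deriv_eq_zero (fun z => (hh' z).differentiableAt) (fun z => (hh' z).deriv) y 0
  have hlin : ∀ y, HasDerivAt (fun z => h z - h' 0 * z) 0 y := fun y => by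
    have := (hh y).sub ((hasDerivAt_id y).const_mul (h' 0))
    rwa [hc y, mul_one, sub_self] at this
  have haff : ∀ y, h y - h' 0 * y = h 0 - h' 0 * 0 := fun y =>
    is_const_of_deriv_eq_zero (fun z => (hlin z).differentiableAt) (fun z => (hlin z).deriv) y 0
  have hslope : h' 0 = 0 := by linarith [haff 1]
  simpa [hslope] using haff x

theorem ContDiff.hasDerivAt_deriv {f : ℝ → ℝ} (hf : ContDiff ℝ (⊤ : ℕ∞) f) (x : ℝ) :
    HasDerivAt f (deriv f x) x :=
  (hf.differentiable (by simp) x).hasDerivAt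

theorem ContDiff.deriv_top {f : ℝ → ℝ} (hf : ContDiff ℝ (⊤ : ℕ∞) f) :
    ContDiff ℝ (⊤ : ℕ∞) (deriv f) :=
  (contDiff_infty_iff_deriv.mp hf).2

/-- The integrated form of the μBurgers equation at a fixed time, with `f` and `g` in the roles of
`u` and `u_t`. -/
theorem muBurgers_integrated_form_at_time {f g : ℝ → ℝ} (hf : ContDiff ℝ (⊤ : ℕ∞) f)
    (hg : ContDiff ℝ (⊤ : ℕ∞) g) (hfper : Function.Periodic f 1) (hgper : Function.Periodic g 1) :
    (∀ x, deriv (deriv g) x + 3 * deriv f x * deriv (deriv f) x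
        + f x * deriv (deriv (deriv f)) x = 0)
      ↔ ∀ x, g x + f x * deriv f x = ∫ y in (0 : ℝ)..1, g y := by
  have hf' := hf.deriv_top
  have hh : ∀ x, HasDerivAt (fun y => g y + f y * deriv f y)
      (deriv g x + (deriv f x * deriv f x + f x * deriv (deriv f) x)) x := fun x =>
    (hg.hasDerivAt_deriv x).add ((hf.hasDerivAt_deriv x).mul (hf'.hasDerivAt_deriv x))
  have hh' : ∀ x, HasDerivAt
      (fun y => deriv g y + (deriv f y * deriv f y + f y * deriv (deriv f) y))
      (deriv (deriv g) x + 3 * deriv f x * deriv (deriv f) x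
        + f x * deriv (deriv (deriv f)) x) x := fun x => by
    have := (hg.deriv_top.hasDerivAt_deriv x).add
      (((hf'.hasDerivAt_deriv x).mul (hf'.hasDerivAt_deriv x)).add
        ((hf.hasDerivAt_deriv x).mul (hf'.deriv_top.hasDerivAt_deriv x)))
    exact this.congr_deriv (by ring)
  constructor
  · intro heq
    have hf1 : f 1 = f 0 := by simpa using hfper 0
    have hg1 : g 1 = g 0 := by simpa using hgper 0
    have hf'1 : deriv f 1 = deriv f 0 := by
      have := deriv_comp_add_const f 1 0
      rw [show (fun y => f (y + 1)) = f from funext hfper, zero_add] at this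
      exact this.symm
    have hconst := eq_apply_zero_of_hasDerivAt_hasDerivAt_zero hh
      (fun x => by simpa only [heq x] using hh' x) (by simp only [hf1, hg1, hf'1])
    have hfint : ∫ y in (0 : ℝ)..1, f y * deriv f y = 0 := by
      have hsq : ∀ y, HasDerivAt (fun z => f z ^ 2 / 2) (f y * deriv f y) y := fun y =>
        (((hf.hasDerivAt_deriv y).pow 2).div_const 2).congr_deriv (by norm_num; ring)
      rw [integral_eq_sub_of_hasDerivAt (fun y _ => hsq y)
        ((hf.continuous.mul hf'.continuous).intervalIntegrable _ _), hf1, sub_self]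
    have hint : ∫ y in (0 : ℝ)..1, (g y + f y * deriv f y) = ∫ y in (0 : ℝ)..1, g y := by
      have hadd := integral_add (hg.continuous.intervalIntegrable (μ := MeasureTheory.volume) 0 1)
        ((hf.continuous.mul hf'.continuous).intervalIntegrable 0 1)
      exact hadd.trans (by simp [hfint])
    intro x
    rw [← hint, integral_congr (fun y _ => hconst y)]
    simpa using hconst x
  · intro heq x
    have hzero : ∀ y, deriv g y + (deriv f y * deriv f y + f y * deriv (deriv f) y) = 0 :=
      fun y => (hh y).unique (by simpa only [funext heq] using hasDerivAt_const y _)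
    exact (hh' x).unique (by simpa only [funext hzero] using hasDerivAt_const x (0 : ℝ))

theorem contDiff_pdt_s16 {u : ℝ × ℝ → ℝ} (hu : ContDiff ℝ (⊤ : ℕ∞) u) :
    ContDiff ℝ (⊤ : ℕ∞) (pdt u) := by
  have hpdt : pdt u = fun p => fderiv ℝ u p (1, 0) := by
    ext p
    have hline : HasDerivAt (fun s : ℝ => (s, p.2)) (1, 0) p.1 :=
      (hasDerivAt_id p.1).prodMk (hasDerivAt_const p.1 p.2)
    exact ((hu.differentiable (by simp) p).hasFDerivAt.comp_hasDerivAt p.1 hline).deriv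
  rw [hpdt]
  exact (hu.fderiv_right (by simp)).clm_apply contDiff_const

/-- a smooth spatially periodic u satisfies the μBurgers equation
`u_txx + 3u_x u_xx + u u_xxx = 0` on `I × ℝ` iff it satisfies
`u_t + u u_x = μ(u_t)` there; in particular `u_t + u u_x` is independent of x. -/
theorem muBurgers_integrated_form
    (u : ℝ × ℝ → ℝ) (hu : ContDiff ℝ (⊤ : ℕ∞) u)
    (hper : ∀ t x, u (t, x + 1) = u (t, x))
    (I : Set ℝ) (hIopen : IsOpen I) (hIconv : Convex ℝ I) :
    (∀ t ∈ I, ∀ x : ℝ,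
        pdx (pdx (pdt u)) (t, x) + 3 * pdx u (t, x) * pdx (pdx u) (t, x)
          + u (t, x) * pdx (pdx (pdx u)) (t, x) = 0)
      ↔ (∀ t ∈ I, ∀ x : ℝ,
          pdt u (t, x) + u (t, x) * pdx u (t, x) = ∫ y in (0:ℝ)..1, pdt u (t, y)) := by
  refine forall₂_congr fun t _ => ?_
  have hslice : ContDiff ℝ (⊤ : ℕ∞) (fun x : ℝ => (t, x)) := contDiff_const.prodMk contDiff_id
  exact muBurgers_integrated_form_at_time (hu.comp hslice) ((contDiff_pdt_s16 hu).comp hslice)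
    (hper t) (fun x => by simp only [Function.comp_apply, pdt, hper])
end
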